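/- Let V be a finite-dimensional complex vector space and let h_1, h_2, h_3 be pairwise commuting linear automorphisms of V, each of finite order. Then Obs(h_1, h_2) + Obs(h_1 h_2, h_3) + [codim(h_1, h_2) + codim(h_1 h_2, h_3) − codim(h_1 h_2) − codim(h_1, h_2, h_3)] = Obs(h_2, h_3) + Obs(h_1, h_2 h_3) + [codim(h_2, h_3) + codim(h_1, h_2 h_3) − codim(h_2 h_3) − codim(h_1, h_2, h_3)], as an equality of rational numbers. -/

import Mathlib

open Complex

/-- The `w`-eigenspace of a linear automorphism `g`, i.e. the kernel of
`g - e^{2πi w}·id`, where the weight `w` is a rational number. -/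
noncomputable def eigenKer {V : Type*} [AddCommGroup V] [Module ℂ V]
    (g : V ≃ₗ[ℂ] V) (w : ℚ) : Submodule ℂ V :=
  LinearMap.ker ((g : V →ₗ[ℂ] V) -
    Complex.exp (2 * Real.pi * Complex.I * (w : ℂ)) • (LinearMap.id : V →ₗ[ℂ] V))

/-- The age (degree shifting number) of a finite order automorphism `g` of order `r`:
`age g = Σ_{j=0}^{r-1} (j/r) · dim_ℂ ker(g - e^{2πij/r}·id)`. -/
noncomputable def age {V : Type*} [AddCommGroup V] [Module ℂ V]
    (g : V ≃ₗ[ℂ] V) : ℚ :=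
  ∑ j ∈ Finset.range (orderOf g),
    ((j : ℚ) / (orderOf g : ℚ)) *
      (Module.finrank ℂ (eigenKer g ((j : ℚ) / (orderOf g : ℚ))) : ℚ)

/-- The common fixed subspace `Fix(g_1, …, g_m) = ⋂ᵢ ker(gᵢ - id)` of a tuple of
linear automorphisms. -/
noncomputable def fixedSpace {V : Type*} [AddCommGroup V] [Module ℂ V]
    {m : ℕ} (g : Fin m → (V ≃ₗ[ℂ] V)) : Submodule ℂ V :=
  ⨅ i, LinearMap.ker ((g i : V →ₗ[ℂ] V) - (LinearMap.id : V →ₗ[ℂ] V))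

/-- `codim(g_1, …, g_m) = dim_ℂ V - dim_ℂ Fix(g_1, …, g_m)`. -/
noncomputable def codim {V : Type*} [AddCommGroup V] [Module ℂ V]
    {m : ℕ} (g : Fin m → (V ≃ₗ[ℂ] V)) : ℚ :=
  (Module.finrank ℂ V : ℚ) - (Module.finrank ℂ (fixedSpace g) : ℚ)

/-- `Obs(g_1, …, g_m) = Σᵢ age(gᵢ) + age((g_1⋯g_m)⁻¹) - codim(g_1, …, g_m)`. -/
noncomputable def Obs {V : Type*} [AddCommGroup V] [Module ℂ V]
    {m : ℕ} (g : Fin m → (V ≃ₗ[ℂ] V)) : ℚ :=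
  (∑ i, age (g i)) + age ((List.ofFn g).prod)⁻¹ - codim g

section AgeDuality

variable {V : Type*} [AddCommGroup V] [Module ℂ V]

theorem mem_eigenKer {g : V ≃ₗ[ℂ] V} {w : ℚ} {x : V} :
    x ∈ eigenKer g w ↔ g x = exp (2 * Real.pi * I * (w : ℂ)) • x := by
  simp [eigenKer, sub_eq_zero]

theorem eigenKer_eq_eigenspace (g : V ≃ₗ[ℂ] V) (w : ℚ) :
    eigenKer g w =
      Module.End.eigenspace (g : V →ₗ[ℂ] V) (exp (2 * Real.pi * I * (w : ℂ))) := by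
  ext x
  rw [mem_eigenKer, Module.End.mem_eigenspace_iff]
  rfl

theorem eigenKer_inv_one_sub (g : V ≃ₗ[ℂ] V) (w : ℚ) :
    eigenKer g⁻¹ (1 - w) = eigenKer g w := by
  ext x
  have hexp : exp (2 * Real.pi * I * ((1 - w : ℚ) : ℂ)) =
      (exp (2 * Real.pi * I * (w : ℂ)))⁻¹ := by
    rw [← exp_neg, ← exp_periodic (-(2 * Real.pi * I * (w : ℂ)))]
    congr 1
    push_cast
    ring
  rw [mem_eigenKer, mem_eigenKer, hexp, LinearEquiv.coe_inv, LinearEquiv.symm_apply_eq,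
    map_smul, eq_inv_smul_iff₀ (exp_ne_zero _), eq_comm]

theorem fixedSpace_singleton (g : V ≃ₗ[ℂ] V) : fixedSpace ![g] = eigenKer g 0 := by
  simp [fixedSpace, eigenKer]

theorem exp_weight_eq_pow (r j : ℕ) :
    exp (2 * Real.pi * I * (((j : ℚ) / (r : ℚ) : ℚ) : ℂ)) =
      exp (2 * Real.pi * I / r) ^ j := by
  rw [← exp_nat_mul]
  congr 1
  push_cast
  ring

theorem isSemisimple_of_isOfFinOrder [FiniteDimensional ℂ V] {g : V ≃ₗ[ℂ] V}
    (hg : IsOfFinOrder g) :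
    Module.End.IsSemisimple (g : V →ₗ[ℂ] V) := by
  refine Module.End.isSemisimple_of_squarefree_aeval_eq_zero
    (p := (Polynomial.X ^ orderOf g - 1 : Polynomial ℂ)) ?_ ?_
  · exact (Polynomial.X_pow_sub_one_separable_iff.2
      (Nat.cast_ne_zero.2 hg.orderOf_pos.ne')).squarefree
  · have h : (g : Module.End ℂ V) ^ orderOf g = 1 := by
      have := congrArg (LinearEquiv.automorphismGroup.toLinearMapMonoidHom) (pow_orderOf_eq_one g)
      rwa [map_pow, map_one] at this
    simp [h]

theorem finrank_eq_sum_finrank_eigenKer [FiniteDimensional ℂ V] {g : V ≃ₗ[ℂ] V}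
    (hg : IsOfFinOrder g) :
    Module.finrank ℂ V = ∑ j ∈ Finset.range (orderOf g),
      Module.finrank ℂ (eigenKer g ((j : ℚ) / (orderOf g : ℚ))) := by
  set r := orderOf g with hr
  have hr0 : r ≠ 0 := hg.orderOf_pos.ne'
  have : NeZero r := ⟨hr0⟩
  have hζ := isPrimitiveRoot_exp r hr0
  have hA : ∀ j : Fin r, eigenKer g (((j : ℕ) : ℚ) / (r : ℚ)) =
      Module.End.eigenspace (g : V →ₗ[ℂ] V) (exp (2 * Real.pi * I / r) ^ (j : ℕ)) := fun j => by
    rw [eigenKer_eq_eigenspace, exp_weight_eq_pow]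
  have hinj : Function.Injective fun j : Fin r => exp (2 * Real.pi * I / r) ^ (j : ℕ) :=
    fun i j h => Fin.ext (hζ.pow_inj i.2 j.2 h)
  have hind : iSupIndep fun j : Fin r => eigenKer g (((j : ℕ) : ℚ) / (r : ℚ)) := by
    simp_rw [hA]
    exact (Module.End.eigenspaces_iSupIndep (g : V →ₗ[ℂ] V)).comp hinj
  have htop : ⨆ j : Fin r, eigenKer g (((j : ℕ) : ℚ) / (r : ℚ)) = ⊤ := by
    rw [eq_top_iff, ← (isSemisimple_of_isOfFinOrder hg).iSup_eigenspace_eq_top]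
    refine iSup_le fun μ x hx => ?_
    rcases eq_or_ne x 0 with rfl | hx0
    · exact zero_mem _
    rw [Module.End.mem_eigenspace_iff] at hx
    have hpow : ∀ n : ℕ, (g ^ n) x = μ ^ n • x := fun n => by
      induction n with
      | zero => simp
      | succ n ih =>
        rw [pow_succ', LinearEquiv.mul_apply, ih, map_smul, pow_succ, mul_smul]
        exact congrArg _ hx
    have hμ : μ ^ r = 1 := by
      have h := hpow r
      rw [hr, pow_orderOf_eq_one, ← hr] at h
      exact smul_left_injective ℂ hx0 (by simpa using h.symm)
    obtain ⟨i, hi, rfl⟩ := hζ.eq_pow_of_pow_eq_one hμ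
    refine Submodule.mem_iSup_of_mem (⟨i, hi⟩ : Fin r) ?_
    rw [hA, Module.End.mem_eigenspace_iff]
    exact hx
  have hint := DirectSum.isInternal_submodule_of_iSupIndep_of_iSup_eq_top hind htop
  rw [← (LinearEquiv.ofBijective
    (DirectSum.coeLinearMap fun j : Fin r => eigenKer g (((j : ℕ) : ℚ) / (r : ℚ))) hint).finrank_eq, Module.finrank_directSum,
    Finset.sum_range]

theorem sum_weight_add_sum_weight_reflect {r : ℕ} (hr : r ≠ 0) {d d' : ℚ → ℚ}
    (hd : ∀ w, d' (1 - w) = d w) :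
    ∑ j ∈ Finset.range r, (j : ℚ) / r * d (j / r) +
        ∑ j ∈ Finset.range r, (j : ℚ) / r * d' (j / r) =
      ∑ j ∈ Finset.range r, d (j / r) - d 0 := by
  obtain ⟨n, rfl⟩ := Nat.exists_eq_succ_of_ne_zero hr
  have hn : (n : ℚ) + 1 ≠ 0 := by positivity
  simp only [Finset.sum_range_succ', Nat.succ_eq_add_one, Nat.cast_add, Nat.cast_one,
    Nat.cast_zero, zero_div, zero_mul, add_zero, add_sub_cancel_right]
  rw [← Finset.sum_range_reflect
    (fun j : ℕ => ((j : ℚ) + 1) / ((n : ℚ) + 1) * d' (((j : ℚ) + 1) / ((n : ℚ) + 1))) n,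
    ← Finset.sum_add_distrib]
  refine Finset.sum_congr rfl fun j hj => ?_
  have hw : (((n - 1 - j : ℕ) : ℚ) + 1) / ((n : ℚ) + 1) =
      1 - ((j : ℚ) + 1) / ((n : ℚ) + 1) := by
    have hj' := Finset.mem_range.1 hj
    rw [Nat.cast_sub (by omega), Nat.cast_sub (by omega), Nat.cast_one]
    field_simp
    ring
  rw [hw, hd]
  ring

theorem age_add_age_inv [FiniteDimensional ℂ V] {g : V ≃ₗ[ℂ] V} (hg : IsOfFinOrder g) :
    age g + age g⁻¹ = codim ![g] := by
  rw [codim, fixedSpace_singleton, finrank_eq_sum_finrank_eigenKer hg, age, age, orderOf_inv,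
    Nat.cast_sum]
  exact sum_weight_add_sum_weight_reflect hg.orderOf_pos.ne'
    (d := fun w => (Module.finrank ℂ (eigenKer g w) : ℚ))
    (d' := fun w => (Module.finrank ℂ (eigenKer g⁻¹ w) : ℚ))
    fun w => by rw [eigenKer_inv_one_sub]

end AgeDuality

theorem Obs_assoc {V : Type*} [AddCommGroup V] [Module ℂ V]
    [FiniteDimensional ℂ V] (h₁ h₂ h₃ : V ≃ₗ[ℂ] V)
    (hc₁₂ : Commute h₁ h₂) (hc₁₃ : Commute h₁ h₃) (hc₂₃ : Commute h₂ h₃)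
    (hf₁ : IsOfFinOrder h₁) (hf₂ : IsOfFinOrder h₂) (hf₃ : IsOfFinOrder h₃) :
    Obs ![h₁, h₂] + Obs ![h₁ * h₂, h₃] +
        (codim ![h₁, h₂] + codim ![h₁ * h₂, h₃] -
          codim ![h₁ * h₂] - codim ![h₁, h₂, h₃]) =
      Obs ![h₂, h₃] + Obs ![h₁, h₂ * h₃] +
        (codim ![h₂, h₃] + codim ![h₁, h₂ * h₃] -
          codim ![h₂ * h₃] - codim ![h₁, h₂, h₃]) := by
  have h₁₂ := age_add_age_inv (hc₁₂.isOfFinOrder_mul hf₁ hf₂)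
  have h₂₃ := age_add_age_inv (hc₂₃.isOfFinOrder_mul hf₂ hf₃)
  simp only [Obs, Fin.sum_univ_two, List.ofFn_succ, List.ofFn_zero, List.prod_cons,
    List.prod_nil, mul_one, Matrix.cons_val_zero, Matrix.cons_val_one, Fin.succ_zero_eq_one,
    mul_assoc] at h₁₂ h₂₃ ⊢
  linarith
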